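/- For all sufficiently large real x, the least x-pseudosquare N_x satisfies N_x ≤ 4^{π(x)} x²; in particular N_x ≤ 4^{(1+o(1))π(x)} as x → ∞, unconditionally. -/

import Mathlib

open scoped BigOperators

/-- The finset of primes `p ≤ x`. -/
noncomputable def primesUpTo (x : ℝ) : Finset ℕ := (Finset.Iic ⌊x⌋₊).filter Nat.Prime

/-- `M(x)`: the product of all primes `p ≤ x`. -/
noncomputable def Mx (x : ℝ) : ℕ := ∏ p ∈ primesUpTo x, p

/-- `π(x)`: the number of primes `p ≤ x`. -/
noncomputable def piX (x : ℝ) : ℕ := (primesUpTo x).card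

/-- The Legendre symbol `(a/p)` (junk value `0` if `p` is not prime). -/
noncomputable def legendre (p : ℕ) (a : ℤ) : ℤ :=
  if hp : p.Prime then @legendreSym p ⟨hp⟩ a else 0

/-- An `x`-pseudosquare: a positive integer that is not a perfect square, is `≡ 1 (mod 8)`,
and has Legendre symbol `(n/p) = 1` for every odd prime `p ≤ x`. -/
def IsPseudosquare (x : ℝ) (n : ℕ) : Prop :=
  0 < n ∧ ¬ IsSquare n ∧ n % 8 = 1 ∧
    ∀ p : ℕ, p.Prime → p ≠ 2 → (p : ℝ) ≤ x → legendre p (n : ℤ) = 1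

/-- `#(S_x ∩ (A, A+N])`: the number of `x`-pseudosquares in the interval `(A, A+N]`. -/
noncomputable def pseudosquaresIn (x A N : ℝ) : ℕ :=
  Set.ncard {n : ℕ | IsPseudosquare x n ∧ A < (n : ℝ) ∧ (n : ℝ) ≤ A + N}

/-- `N_x`: the least `x`-pseudosquare. -/
noncomputable def leastPseudosquare (x : ℝ) : ℕ := sInf {n : ℕ | IsPseudosquare x n}

open Filter in
/-- For large `y`, Chebyshev's lower bound in the form `y ≤ 4 π(y) log y`. -/
theorem eventually_le_primeCounting_mul_log :
    ∀ᶠ y : ℝ in atTop, y ≤ 4 * (Nat.primeCounting ⌊y⌋₊ * Real.log y) := by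
  have hlog := Real.isLittleO_log_id_atTop.bound (show (0 : ℝ) < 1 / 16 by norm_num)
  filter_upwards [eventually_ge_atTop 100, hlog] with y hy hly
  have hy0 : 0 < Real.log y := Real.log_pos (by linarith)
  have h := Chebyshev.pi_ge' (x := y) (by linarith)
  rw [div_le_iff₀ hy0] at h
  simp only [id, Real.norm_eq_abs, abs_of_pos hy0, abs_of_pos (show 0 < y by linarith)] at hly
  have h2 : Real.log (y + 2) ≤ Real.log 2 + Real.log y := by
    rw [← Real.log_mul (by norm_num) (by linarith)]
    exact Real.log_le_log (by linarith) (by linarith)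
  nlinarith [Real.log_two_gt_d9, Real.log_two_lt_d9]

open Filter in
/-- The primes have density zero. -/
theorem eventually_primeCounting_le_mul {ε : ℝ} (hε : 0 < ε) :
    ∀ᶠ x : ℝ in atTop, (Nat.primeCounting ⌊x⌋₊ : ℝ) ≤ ε * x := by
  filter_upwards [Chebyshev.eventually_primeCounting_le one_pos, eventually_gt_atTop 1,
    Real.tendsto_log_atTop.eventually_ge_atTop ((Real.log 4 + 1) / ε)] with x hx hx1 hl
  refine hx.trans ?_
  rw [div_le_iff₀ (Real.log_pos hx1)]
  rw [div_le_iff₀ hε] at hl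
  nlinarith

open Filter in
/-- Up to `2 ^ π(x) * x` there are many more primes than classes of quadratic characters. -/
theorem eventually_lt_primeCounting_two_pow_mul :
    ∀ᶠ x : ℝ in atTop, 2 * 2 ^ Nat.primeCounting ⌊x⌋₊ + Nat.primeCounting ⌊x⌋₊ <
      Nat.primeCounting ⌊(2 : ℝ) ^ Nat.primeCounting ⌊x⌋₊ * x⌋₊ := by
  have hlog := Real.isLittleO_log_id_atTop.bound (show (0 : ℝ) < 1 / 32 by norm_num)
  obtain ⟨y₀, hy₀⟩ := eventually_atTop.1 eventually_le_primeCounting_mul_log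
  filter_upwards [eventually_primeCounting_le_mul (show (0 : ℝ) < 1 / 32 by norm_num), hlog,
    eventually_gt_atTop 1, eventually_ge_atTop y₀] with x hk hlx hx1 hxy
  generalize Nat.primeCounting ⌊x⌋₊ = k at *
  have hx0 : 0 < Real.log x := Real.log_pos hx1
  simp only [id, Real.norm_eq_abs, abs_of_pos hx0, abs_of_pos (show 0 < x by linarith)] at hlx
  have h2k : (1 : ℝ) ≤ 2 ^ k := one_le_pow₀ (by norm_num)
  have h := hy₀ (2 ^ k * x) (hxy.trans (by nlinarith))
  have hl : Real.log (2 ^ k * x) ≤ 1 / 16 * x := by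
    rw [Real.log_mul (by positivity) (by linarith), Real.log_pow]
    nlinarith [Real.log_two_lt_d9, (Nat.cast_nonneg k : (0 : ℝ) ≤ k)]
  by_contra! hcon
  have hlt : 2 * 2 ^ k + k < 3 * 2 ^ k := by have := Nat.lt_two_pow_self (n := k); omega
  have hcon' : (Nat.primeCounting ⌊(2 : ℝ) ^ k * x⌋₊ : ℝ) ≤ 3 * 2 ^ k := by
    exact_mod_cast hcon.trans hlt.le
  have hmul := mul_le_mul hcon' hl (Real.log_nonneg (by nlinarith)) (by positivity)
  have hpos : 0 < (2 : ℝ) ^ k * x := by positivity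
  nlinarith

theorem primesUpTo_eq_primesLE (x : ℝ) : primesUpTo x = Nat.primesLE ⌊x⌋₊ := by
  ext p
  simp [primesUpTo, Nat.mem_primesLE]

theorem piX_eq_primeCounting (x : ℝ) : piX x = Nat.primeCounting ⌊x⌋₊ := by
  rw [piX, primesUpTo_eq_primesLE, Nat.primesLE_card_eq_primeCounting]

theorem Nat.Prime.not_isSquare_mul {p q : ℕ} (hp : p.Prime) (hq : q.Prime) (hpq : p ≠ q) :
    ¬ IsSquare (p * q) := by
  rintro ⟨r, hr⟩
  obtain ⟨s, rfl⟩ : p ∣ r := by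
    have : p ∣ r * r := ⟨q, hr.symm⟩
    simpa [hp.dvd_mul] using this
  have hq' : q = p * (s * s) := Nat.eq_of_mul_eq_mul_left hp.pos (by rw [hr]; ring)
  exact hpq ((Nat.prime_dvd_prime_iff_eq hp hq).1 ⟨_, hq'⟩)

theorem legendre_mul_eq_one {q a b : ℕ} (hq : q.Prime) (ha : ¬ q ∣ a) (hb : ¬ q ∣ b)
    (h : legendre q a = 1 ↔ legendre q b = 1) : legendre q ((a * b : ℕ) : ℤ) = 1 := by
  have : Fact q.Prime := ⟨hq⟩
  have ha' : ((a : ℤ) : ZMod q) ≠ 0 := by simpa [ZMod.natCast_eq_zero_iff] using ha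
  have hb' : ((b : ℤ) : ZMod q) ≠ 0 := by simpa [ZMod.natCast_eq_zero_iff] using hb
  simp only [legendre, hq, dite_true, Nat.cast_mul, legendreSym.mul] at h ⊢
  rcases legendreSym.eq_one_or_neg_one q ha' with h1 | h1 <;>
    rcases legendreSym.eq_one_or_neg_one q hb' with h2 | h2 <;> simp_all

/-- The product of two distinct primes exceeding `x` with the same quadratic behaviour
is a pseudosquare. -/
theorem isPseudosquare_mul_of_prime {x : ℝ} {p p' : ℕ} (hp : p.Prime) (hp' : p'.Prime)
    (hne : p ≠ p') (hpx : x < p) (hpx' : x < p') (hp2 : p ≠ 2) (hmod : p % 8 = p' % 8)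
    (hleg : ∀ q : ℕ, q.Prime → q ≠ 2 → (q : ℝ) ≤ x →
      (legendre q p = 1 ↔ legendre q p' = 1)) :
    IsPseudosquare x (p * p') := by
  refine ⟨Nat.mul_pos hp.pos hp'.pos, hp.not_isSquare_mul hp' hne, ?_, fun q hq hq2 hqx ↦ ?_⟩
  · have hodd := hp.eq_two_or_odd.resolve_left hp2
    rw [Nat.mul_mod, ← hmod]
    have : p % 8 = 1 ∨ p % 8 = 3 ∨ p % 8 = 5 ∨ p % 8 = 7 := by omega
    rcases this with h | h | h | h <;> rw [h]
  · have hndvd {r : ℕ} (hr : r.Prime) (hrx : x < r) : ¬ q ∣ r := by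
      rw [Nat.prime_dvd_prime_iff_eq hq hr]
      rintro rfl
      exact hqx.not_gt hrx
    exact legendre_mul_eq_one hq (hndvd hp hpx) (hndvd hp' hpx') (hleg q hq hq2 hqx)

/-- If there are more primes in `(x, y]` than quadratic classes, some pseudosquare is at
most `y ^ 2`. -/
theorem exists_isPseudosquare_le_sq {x y : ℝ} (hx : 2 ≤ x) (hy : 0 ≤ y)
    (hcard : 2 * 2 ^ piX x + piX x < piX y) :
    ∃ n : ℕ, IsPseudosquare x n ∧ (n : ℝ) ≤ y ^ 2 := by
  classical
  let S := primesUpTo y \ primesUpTo x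
  let O := (primesUpTo x).erase 2
  let T : Finset (ℕ × Finset ℕ) := {1, 3, 5, 7} ×ˢ O.powerset
  let f : ℕ → ℕ × Finset ℕ := fun p ↦ (p % 8, O.filter fun q ↦ legendre q p = 1)
  have mem_iff {z : ℝ} (hz : 0 ≤ z) (p : ℕ) : p ∈ primesUpTo z ↔ (p : ℝ) ≤ z ∧ p.Prime := by
    rw [primesUpTo_eq_primesLE, Nat.mem_primesLE, Nat.le_floor_iff hz]
  have hS {p : ℕ} (hp : p ∈ S) : p.Prime ∧ x < p ∧ (p : ℝ) ≤ y := by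
    rw [Finset.mem_sdiff, mem_iff hy, mem_iff (by linarith)] at hp
    exact ⟨hp.1.2, not_le.1 fun h ↦ hp.2 ⟨h, hp.1.2⟩, hp.1.1⟩
  have hS2 {p : ℕ} (hp : p ∈ S) : p ≠ 2 := by
    rintro rfl
    have := (hS hp).2.1
    norm_num at this
    linarith
  have hT : T.card = 2 * 2 ^ piX x := by
    have h2 : 2 ∈ primesUpTo x := (mem_iff (by linarith) 2).2 ⟨by exact_mod_cast hx, Nat.prime_two⟩
    have h1 := Finset.card_erase_add_one h2
    change O.card + 1 = piX x at h1
    rw [← h1, Finset.card_product, Finset.card_powerset, pow_succ]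
    have h4 : ({1, 3, 5, 7} : Finset ℕ).card = 4 := rfl
    rw [h4]
    ring
  have hlt : T.card < S.card := by
    have := Finset.le_card_sdiff (primesUpTo x) (primesUpTo y)
    change piX y - piX x ≤ S.card at this
    omega
  have hmaps : ∀ p ∈ S, f p ∈ T := fun p hp ↦ by
    have hodd := (hS hp).1.eq_two_or_odd.resolve_left (hS2 hp)
    refine Finset.mem_product.2 ⟨?_, Finset.mem_powerset.2 (Finset.filter_subset _ _)⟩
    simp only [f, Finset.mem_insert, Finset.mem_singleton]
    omega
  obtain ⟨p, hp, p', hp', hne, heq⟩ := Finset.exists_ne_map_eq_of_card_lt_of_maps_to hlt hmaps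
  obtain ⟨hmod, hfil⟩ := Prod.ext_iff.1 heq
  refine ⟨p * p', isPseudosquare_mul_of_prime (hS hp).1 (hS hp').1 hne (hS hp).2.1 (hS hp').2.1
    (hS2 hp) hmod fun q hq hq2 hqx ↦ ?_, ?_⟩
  · have hqO : q ∈ O := Finset.mem_erase.2 ⟨hq2, (mem_iff (by linarith) q).2 ⟨hqx, hq⟩⟩
    simpa [f, hqO] using Finset.ext_iff.1 hfil q
  · rw [Nat.cast_mul, sq]
    exact mul_le_mul (hS hp).2.2 (hS hp').2.2 (Nat.cast_nonneg _) hy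

/-- For all sufficiently large `x`, an `x`-pseudosquare exists and the least one satisfies
`N_x ≤ 4^{π(x)} x²` (so `N_x ≤ 4^{(1+o(1))π(x)}`), unconditionally. -/
theorem least_pseudosquare_bound :
    ∃ x₀ : ℝ, ∀ x : ℝ, x₀ ≤ x →
      {n : ℕ | IsPseudosquare x n}.Nonempty ∧
      (leastPseudosquare x : ℝ) ≤ 4 ^ piX x * x ^ 2 := by
  obtain ⟨x₀, h⟩ := Filter.eventually_atTop.1 eventually_lt_primeCounting_two_pow_mul
  refine ⟨max x₀ 2, fun x hx ↦ ?_⟩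
  have hx2 : 2 ≤ x := (le_max_right _ _).trans hx
  have hcard := h x ((le_max_left _ _).trans hx)
  simp only [← piX_eq_primeCounting] at hcard
  obtain ⟨n, hn, hle⟩ := exists_isPseudosquare_le_sq hx2 (by positivity) hcard
  refine ⟨⟨n, hn⟩, le_trans (Nat.cast_le.2 (Nat.sInf_le hn)) (hle.trans_eq ?_)⟩
  rw [mul_pow, ← pow_mul, mul_comm (piX x), pow_mul]
  norm_num
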